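/- Every natural number m has a canonical skew binary representation: there exist digits α_n, ..., α_1 with each α_i ∈ {0,1} except possibly the lowest-order nonzero digit which may equal 2, such that m = Σ_{i=1}^{n} α_i (2^i − 1). -/

import Mathlib

/-- Value denoted by a list of skew binary digits (index `i` of the list is the
digit at position `i+1`, worth `2^(i+1) - 1`). -/
def skewVal (l : List ℕ) : ℕ :=
  ∑ i ∈ Finset.range l.length, l.getD i 0 * (2 ^ (i + 1) - 1)

/-- A digit list is canonical skew binary if every digit is at most `2` and a
digit equal to `2` has only zeros below it (it is the lowest-order nonzero digit). -/
def CanonicalSkew (l : List ℕ) : Prop :=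
  (∀ i, l.getD i 0 ≤ 2) ∧ (∀ i, l.getD i 0 = 2 → ∀ j < i, l.getD j 0 = 0)

theorem skew_aux (n : ℕ) : ∀ m, m + 2 ≤ 2 ^ (n + 1) → ∃ f : ℕ → ℕ, (∀ i, n ≤ i → f i = 0) ∧
    (∀ i, f i ≤ 2) ∧ (∀ i, f i = 2 → ∀ j < i, f j = 0) ∧
    ∑ i ∈ Finset.range n, f i * (2 ^ (i + 1) - 1) = m := by
  induction n with
  | zero =>
    intro m hm
    exact ⟨fun _ => 0, by simp, by simp, by simp, by simp at hm ⊢; omega⟩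
  | succ n ih =>
    intro m hm
    have hp : 2 ^ (n + 1 + 1) = 2 * 2 ^ (n + 1) := by ring
    by_cases h1 : m + 2 ≤ 2 ^ (n + 1)
    · obtain ⟨f, h0, h2, h3, h4⟩ := ih m h1
      refine ⟨f, fun i hi => h0 i (by omega), h2, h3, ?_⟩
      rw [Finset.sum_range_succ, h4, h0 n le_rfl]; simp
    by_cases h2 : m + 2 = 2 ^ (n + 1 + 1)
    · refine ⟨fun i => if i = n then 2 else 0, ?_, ?_, ?_, ?_⟩
      · intro i hi; simp; omega
      · intro i; dsimp only; split_ifs <;> omega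
      · intro i hi j hj
        dsimp only at *
        split_ifs at * <;> omega
      · rw [Finset.sum_range_succ, Finset.sum_eq_zero]
        · simp; omega
        · intro i hi
          have := Finset.mem_range.1 hi
          simp [this.ne]
    · obtain ⟨f, h0, h5, h3, h4⟩ := ih (m - (2 ^ (n + 1) - 1)) (by omega)
      refine ⟨fun i => if i = n then 1 else f i, ?_, ?_, ?_, ?_⟩
      · intro i hi
        have := h0 i (by omega)
        dsimp only; split_ifs <;> omega
      · intro i
        have := h5 i
        dsimp only; split_ifs <;> omega
      · intro i hi j hj
        dsimp only at *
        by_cases hin : i = n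
        · simp [hin] at hi
        · rw [if_neg hin] at hi
          have : i < n := by
            by_contra hc
            have := h0 i (by omega)
            omega
          rw [if_neg (by omega)]
          exact h3 i hi j hj
      · have e : ∑ i ∈ Finset.range n, (if i = n then 1 else f i) * (2 ^ (i + 1) - 1)
            = m - (2 ^ (n + 1) - 1) := by
          rw [← h4]
          refine Finset.sum_congr rfl fun i hi => ?_
          have := Finset.mem_range.1 hi
          rw [if_neg this.ne]
        rw [Finset.sum_range_succ, e]
        simp; omega

/-- Every natural number has a canonical skew binary representation. -/
theorem stmt8 (m : ℕ) : ∃ l : List ℕ, CanonicalSkew l ∧ skewVal l = m := by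
  have hm : m + 2 ≤ 2 ^ (m + 1) := by
    have : m < 2 ^ m := Nat.lt_two_pow_self
    have : 2 ^ (m + 1) = 2 * 2 ^ m := by ring
    omega
  obtain ⟨f, h0, h2, h3, h4⟩ := skew_aux m m hm
  have hg : ∀ i, ((List.range m).map f).getD i 0 = f i := by
    intro i
    by_cases hi : i < m
    · simp [List.getD, hi]
    · simp [List.getD, hi, h0 i (by omega)]
  refine ⟨(List.range m).map f, ⟨?_, ?_⟩, ?_⟩
  · intro i; rw [hg]; exact h2 i
  · intro i hi j hj; rw [hg] at *; exact h3 i hi j hj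
  · simp only [skewVal, hg, List.length_map, List.length_range]; exact h4
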